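/- Let n ≥ 1 and let G be a non-elementary discrete subgroup of PU(1,n), i.e., its Chen–Greenberg limit set Λ_CG(G) contains more than two points. Then Λ_CG(G) is a perfect set (it is closed and has no isolated points), it has empty interior in ℙⁿ_ℂ, and for every z ∈ Λ_CG(G) the orbit G·z is dense in Λ_CG(G). -/

import Mathlib

open Filter Topology Matrix

noncomputable section

abbrev Vec (n : ℕ) := Fin (n + 1) → ℂ
abbrev Mat (n : ℕ) := Matrix (Fin (n + 1)) (Fin (n + 1)) ℂ
abbrev Pn (n : ℕ) := Projectivization ℂ (Vec n)

instance (n : ℕ) : TopologicalSpace (Pn n) :=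
  inferInstanceAs (TopologicalSpace (Quotient (projectivizationSetoid ℂ (Vec n))))

def herm (n : ℕ) (u v : Vec n) : ℂ :=
  -(u 0 * (starRingEnd ℂ) (v 0)) + ∑ j : Fin n, u j.succ * (starRingEnd ℂ) (v j.succ)

def Hball (n : ℕ) : Set (Pn n) :=
  {p | ∃ v : Vec n, ∃ hv : v ≠ 0, p = Projectivization.mk ℂ v hv ∧ (herm n v v).re < 0}

def Hbdry (n : ℕ) : Set (Pn n) :=
  {p | ∃ v : Vec n, ∃ hv : v ≠ 0, p = Projectivization.mk ℂ v hv ∧ herm n v v = 0}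

abbrev GLn (n : ℕ) := Matrix.GeneralLinearGroup (Fin (n + 1)) ℂ
abbrev PGLn (n : ℕ) := GLn n ⧸ Subgroup.center (GLn n)

lemma glInj {n : ℕ} (A : GLn n) : Function.Injective (Matrix.mulVecLin (A : Mat n)) := by
  intro x y h
  simp only [Matrix.mulVecLin_apply] at h
  have h2 : ((A⁻¹ : GLn n) : Mat n) *ᵥ ((A : Mat n) *ᵥ x)
      = ((A⁻¹ : GLn n) : Mat n) *ᵥ ((A : Mat n) *ᵥ y) := by rw [h]
  rwa [Matrix.mulVec_mulVec, Matrix.mulVec_mulVec, Units.inv_mul, Matrix.one_mulVec,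
    Matrix.one_mulVec] at h2

def actGL {n : ℕ} (A : GLn n) : Pn n → Pn n :=
  Projectivization.map (Matrix.mulVecLin (A : Mat n)) (glInj A)

def act {n : ℕ} (g : PGLn n) : Pn n → Pn n := actGL (Quotient.out g)

-- part 2 --

/-- The subset `U(1,n)` of `GL(n+1,ℂ)`: matrices preserving the Hermitian form. -/
def unitaryGL (n : ℕ) : Set (GLn n) :=
  {A | ∀ u v : Vec n, herm n ((A : Mat n) *ᵥ u) ((A : Mat n) *ᵥ v) = herm n u v}

/-- `PU(1,n)`, the image of `U(1,n)` in `PGL(n+1,ℂ)`. -/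
def PUset (n : ℕ) : Set (PGLn n) := (QuotientGroup.mk : GLn n → PGLn n) '' unitaryGL n

/-- The center of the ball `𝐇ⁿ_ℂ`, namely the image of `(1,0,…,0)`. -/
def basePt (n : ℕ) : Pn n :=
  Projectivization.mk ℂ (Pi.single 0 1) (by
    intro h
    have := congrFun h 0
    simp [Pi.single_eq_same] at this)

lemma basePt_mem_Hball (n : ℕ) : basePt n ∈ Hball n := by
  refine ⟨Pi.single 0 1, _, rfl, ?_⟩
  have : herm n (Pi.single 0 1) (Pi.single 0 1) = -1 := by
    simp [herm, Pi.single_eq_same, Pi.single_eq_of_ne (Fin.succ_ne_zero _)]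
  rw [this]
  norm_num

/-- The set of accumulation points of the orbit `G • x` in `ℙⁿ_ℂ`: limits of
`g_m • x` along sequences of pairwise distinct elements of `G`. -/
def accPts {n : ℕ} (G : Subgroup (PGLn n)) (x : Pn n) : Set (Pn n) :=
  {z | ∃ g : ℕ → G, Function.Injective g ∧
    Tendsto (fun m => act (g m : PGLn n) x) atTop (𝓝 z)}

/-- The Chen–Greenberg limit set of `G`. -/
def LambdaCG {n : ℕ} (G : Subgroup (PGLn n)) : Set (Pn n) := accPts G (basePt n)

/-- Uniform convergence on `K` of a sequence of self-maps of `ℙⁿ_ℂ` to `F`, expressed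
via open neighborhoods of the diagonal.  Since `ℙⁿ_ℂ` is compact Hausdorff, this is
equivalent to uniform convergence on `K` with respect to any metric inducing its
topology. -/
def UnifConvOn {n : ℕ} (f : ℕ → Pn n → Pn n) (F : Pn n → Pn n) (K : Set (Pn n)) : Prop :=
  ∀ W : Set (Pn n × Pn n), IsOpen W → (∀ y, (y, y) ∈ W) →
    ∀ᶠ m in atTop, ∀ x ∈ K, (F x, f m x) ∈ W

/-- Uniform convergence on all compact subsets of `S`. -/
def UnifConvOnCompacts {n : ℕ} (f : ℕ → Pn n → Pn n) (F : Pn n → Pn n)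
    (S : Set (Pn n)) : Prop :=
  ∀ K ⊆ S, IsCompact K → UnifConvOn f F K

/-- The equicontinuity region of a subgroup `G ≤ PGL(n+1,ℂ)`: points having an open
neighborhood `U` on which every sequence in `G` has a subsequence converging uniformly
on compact subsets of `U`. -/
def eqRegion {n : ℕ} (G : Subgroup (PGLn n)) : Set (Pn n) :=
  {z | ∃ U : Set (Pn n), IsOpen U ∧ z ∈ U ∧
    ∀ g : ℕ → G, ∃ φ : ℕ → ℕ, StrictMono φ ∧ ∃ F : Pn n → Pn n,
      UnifConvOnCompacts (fun m => act (g (φ m) : PGLn n)) F U}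

/-- The equicontinuity region of the family of maps `{f m : m ∈ ℕ}`. -/
def eqRegionFam {n : ℕ} (f : ℕ → Pn n → Pn n) : Set (Pn n) :=
  {z | ∃ U : Set (Pn n), IsOpen U ∧ z ∈ U ∧
    ∀ s : ℕ → ℕ, ∃ φ : ℕ → ℕ, StrictMono φ ∧ ∃ F : Pn n → Pn n,
      UnifConvOnCompacts (fun k => f (s (φ k))) F U}

/-- The projectivization of a linear subspace `W ⊆ ℂ^{n+1}`, as a subset of `ℙⁿ_ℂ`. -/
def projSet {n : ℕ} (W : Submodule ℂ (Vec n)) : Set (Pn n) := {p | p.rep ∈ W}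

/-- A complex projective hyperplane: the projectivization of an `n`-dimensional
subspace of `ℂ^{n+1}`. -/
def IsProjHyperplane {n : ℕ} (S : Set (Pn n)) : Prop :=
  ∃ W : Submodule ℂ (Vec n), Module.finrank ℂ W = n ∧ S = projSet W

/-- A complex projective line: the projectivization of a `2`-dimensional subspace. -/
def IsProjLine {n : ℕ} (S : Set (Pn n)) : Prop :=
  ∃ W : Submodule ℂ (Vec n), Module.finrank ℂ W = 2 ∧ S = projSet W

/-- The kernel in `ℙⁿ_ℂ` of the quasi-projective map induced by the nonzero matrix `M`. -/
def qKer {n : ℕ} (M : Mat n) : Set (Pn n) := projSet (LinearMap.ker (Matrix.mulVecLin M))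

/-- The image in `ℙⁿ_ℂ` of the quasi-projective map induced by the nonzero matrix `M`. -/
def qIm {n : ℕ} (M : Mat n) : Set (Pn n) := projSet (LinearMap.range (Matrix.mulVecLin M))

/-- The quasi-projective map `ℙⁿ_ℂ ∖ Ker(M) → ℙⁿ_ℂ` induced by the nonzero matrix `M`
(extended to all of `ℙⁿ_ℂ` by the identity on `Ker(M)`, where it is irrelevant). -/
def qMap {n : ℕ} (M : Mat n) : Pn n → Pn n := fun p =>
  if h : M *ᵥ p.rep ≠ 0 then Projectivization.mk ℂ (M *ᵥ p.rep) h else p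

/-- Convergence of a sequence of transformations of `ℙⁿ_ℂ` to the quasi-projective map
induced by `M`, in the sense of quasi-projective transformations: uniform convergence
on compact subsets of `ℙⁿ_ℂ ∖ Ker(M)`. -/
def QPConv {n : ℕ} (f : ℕ → Pn n → Pn n) (M : Mat n) : Prop :=
  UnifConvOnCompacts f (qMap M) (qKer M)ᶜ

/-- The special linear group `SL(n+1,ℂ)`. -/
abbrev SLn (n : ℕ) := Matrix.SpecialLinearGroup (Fin (n + 1)) ℂ

/-- The projective special linear group `PSL(n+1,ℂ) = SL(n+1,ℂ)/center`. -/
abbrev PSLn (n : ℕ) := SLn n ⧸ Subgroup.center (SLn n)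

/-- The projective transformation induced by an element of `SL(n+1,ℂ)`. -/
def actSL {n : ℕ} (A : SLn n) : Pn n → Pn n := actGL (Matrix.SpecialLinearGroup.toGL A)

/-- The projective transformation induced by an element of `PSL(n+1,ℂ)` (via an
arbitrary representative; all representatives induce the same transformation). -/
def actPSL {n : ℕ} (g : PSLn n) : Pn n → Pn n := actSL (Quotient.out g)

/-- The projective hyperplane tangent to `∂𝐇ⁿ_ℂ` at `p`: the projectivization of the
Hermitian orthogonal complement of a lift of `p`. -/
def tangentAt {n : ℕ} (p : Pn n) : Set (Pn n) := {q | herm n q.rep p.rep = 0}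

end

noncomputable section

section ProjectivePoints

variable {n : ℕ}

/-- The point of `ℙⁿ_ℂ` spanned by a vector, with junk value `basePt n` at `0`. -/
def pt (v : Vec n) : Pn n := if h : v = 0 then basePt n else Projectivization.mk ℂ v h

lemma pt_of_ne {v : Vec n} (h : v ≠ 0) : pt v = Projectivization.mk ℂ v h := dif_neg h

lemma pt_rep (p : Pn n) : pt p.rep = p := by
  rw [pt_of_ne p.rep_nonzero, Projectivization.mk_rep]

lemma ne_zero_of_apply_zero {v : Vec n} (h : v 0 ≠ 0) : v ≠ 0 := by
  rintro rfl; exact h rfl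

lemma ne_zero_of_apply_zero_eq_one {v : Vec n} (h : v 0 = 1) : v ≠ 0 :=
  ne_zero_of_apply_zero (by rw [h]; exact one_ne_zero)

lemma pt_eq_iff {u v : Vec n} (hu : u ≠ 0) (hv : v ≠ 0) : pt u = pt v ↔ ∃ a : ℂ, a • v = u := by
  rw [pt_of_ne hu, pt_of_ne hv, Projectivization.mk_eq_mk_iff']

lemma pt_smul {a : ℂ} (ha : a ≠ 0) {v : Vec n} (hv : v ≠ 0) : pt (a • v) = pt v :=
  (pt_eq_iff (smul_ne_zero ha hv) hv).2 ⟨a, rfl⟩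

lemma basePt_eq_pt : basePt n = pt (Pi.single 0 1) := by
  rw [pt_of_ne (ne_zero_of_apply_zero_eq_one (by simp))]; rfl

lemma isQuotientMap_mk' : IsQuotientMap (Projectivization.mk' ℂ : {v : Vec n // v ≠ 0} → Pn n) :=
  isQuotientMap_quot_mk

lemma continuousAt_pt {v : Vec n} (hv : v ≠ 0) : ContinuousAt (pt : Vec n → Pn n) v := by
  have ho : IsOpen {v : Vec n | v ≠ 0} := isOpen_ne
  refine ContinuousOn.continuousAt ?_ (ho.mem_nhds hv)
  rw [continuousOn_iff_continuous_domRestrict]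
  exact (isQuotientMap_mk' (n := n)).continuous.congr fun w => (pt_of_ne w.2).symm

/-- The affine chart `v₀ ≠ 0` of `ℙⁿ_ℂ`, with junk value `0` on the hyperplane `v₀ = 0`. -/
def chart (p : Pn n) : Vec n := (p.rep 0)⁻¹ • p.rep

lemma chart_pt {v : Vec n} (hv : v ≠ 0) : chart (pt v) = (v 0)⁻¹ • v := by
  obtain ⟨a, ha⟩ := (pt_eq_iff (pt v).rep_nonzero hv).1 (pt_rep _)
  have ha0 : a ≠ 0 := by
    rintro rfl
    exact (pt v).rep_nonzero (by simpa using ha.symm)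
  rw [chart, ← ha]
  ext i
  simp only [Pi.smul_apply, smul_eq_mul, mul_inv]
  field_simp

lemma pt_chart {p : Pn n} (hp : chart p 0 ≠ 0) : pt (chart p) = p := by
  have h0 : p.rep 0 ≠ 0 := by
    intro h
    simp [chart, h] at hp
  rw [chart, pt_smul (inv_ne_zero h0) p.rep_nonzero, pt_rep]

lemma continuousAt_chart {v : Vec n} (hv : v 0 = 1) :
    ContinuousAt (chart : Pn n → Vec n) (pt v) := by
  have hopen : IsOpen {p : Pn n | p.rep 0 ≠ 0} ∧ ContinuousOn (chart : Pn n → Vec n)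
      {p : Pn n | p.rep 0 ≠ 0} := by
    have hpre : ∀ w : {v : Vec n // v ≠ 0},
        (Projectivization.mk' ℂ w : Pn n).rep 0 ≠ 0 ↔ w.1 0 ≠ 0 := by
      rintro ⟨w, hw⟩
      obtain ⟨a, ha⟩ := Projectivization.exists_smul_eq_mk_rep ℂ w hw
      change (Projectivization.mk ℂ w hw).rep 0 ≠ 0 ↔ w 0 ≠ 0
      rw [← ha]
      simp [Units.smul_def]
    have ho : IsOpen {w : {v : Vec n // v ≠ 0} | w.1 0 ≠ 0} :=
      isOpen_ne_fun ((continuous_apply 0).comp continuous_subtype_val) continuous_const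
    have ho' : IsOpen {p : Pn n | p.rep 0 ≠ 0} := by
      rw [← isQuotientMap_mk'.isOpen_preimage]
      convert ho using 1
      ext w
      exact hpre w
    refine ⟨ho', (continuousOn_open_iff ho').2 fun V hV => ?_⟩
    rw [← isQuotientMap_mk'.isOpen_preimage]
    have hc : ContinuousOn (fun w : {v : Vec n // v ≠ 0} => (w.1 0)⁻¹ • w.1)
        {w | w.1 0 ≠ 0} := by
      refine ContinuousOn.smul (ContinuousOn.inv₀ ?_ fun w hw => hw) ?_
      · exact ((continuous_apply 0).comp continuous_subtype_val).continuousOn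
      · exact continuous_subtype_val.continuousOn
    convert (continuousOn_open_iff ho).1 hc V hV using 1
    ext w
    have : chart (Projectivization.mk' ℂ w : Pn n) = (w.1 0)⁻¹ • w.1 := by
      have := chart_pt w.2
      rwa [pt_of_ne w.2] at this
    simp only [Set.mem_preimage, Set.mem_inter_iff, Set.mem_ofPred_eq, this]
    exact and_congr_left fun _ => hpre w
  refine hopen.2.continuousAt (hopen.1.mem_nhds ?_)
  have h1 : chart (pt v) 0 ≠ 0 := by
    rw [chart_pt (ne_zero_of_apply_zero_eq_one hv)]
    simp [hv]
  intro h
  simp [chart, h] at h1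

lemma chart_pt_of_one {v : Vec n} (hv : v 0 = 1) : chart (pt v) = v := by
  rw [chart_pt (ne_zero_of_apply_zero_eq_one hv), hv]; simp

lemma nhds_pt {v : Vec n} (hv : v 0 = 1) : 𝓝 (pt v) = comap chart (𝓝 v) := by
  apply le_antisymm
  · rw [← tendsto_iff_comap]
    simpa [ContinuousAt, chart_pt_of_one hv] using continuousAt_chart hv
  · intro W hW
    have h1 : {w : Vec n | pt w ∈ W} ∈ 𝓝 v :=
      continuousAt_pt (ne_zero_of_apply_zero_eq_one hv) hW
    have h2 : {w : Vec n | w 0 ≠ 0} ∈ 𝓝 v :=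
      (isOpen_ne_fun (continuous_apply 0) continuous_const).mem_nhds (by simp [hv])
    refine mem_comap.2 ⟨_, inter_mem h1 h2, ?_⟩
    rintro p ⟨hp1, hp2⟩
    simpa [pt_chart hp2] using hp1

lemma tendsto_pt_unique {ι : Type*} {l : Filter ι} [l.NeBot] {f : ι → Pn n} {u v : Vec n}
    (hu : u 0 = 1) (hv : v 0 = 1) (h1 : Tendsto f l (𝓝 (pt u))) (h2 : Tendsto f l (𝓝 (pt v))) :
    u = v := by
  rw [nhds_pt hu, tendsto_comap_iff] at h1
  rw [nhds_pt hv, tendsto_comap_iff] at h2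
  exact tendsto_nhds_unique h1 h2

lemma eq_pt_of_tendsto_const {ι : Type*} {l : Filter ι} [l.NeBot] {p : Pn n} {v : Vec n}
    (hv : v 0 = 1) (h : Tendsto (fun _ => p) l (𝓝 (pt v))) : p = pt v := by
  rw [nhds_pt hv, tendsto_comap_iff] at h
  have h1 : chart p = v := tendsto_nhds_unique tendsto_const_nhds h
  rw [← pt_chart (p := p) (by simp [h1, hv]), h1]

lemma tendsto_pt_smul {ι : Type*} {l : Filter ι} {f : ι → Vec n} {a : ι → ℂ} {u : Vec n}
    (hu : u ≠ 0) (hf : ∀ i, f i ≠ 0) (ha : ∀ᶠ i in l, a i ≠ 0)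
    (h : Tendsto (fun i => a i • f i) l (𝓝 u)) :
    Tendsto (fun i => pt (f i)) l (𝓝 (pt u)) := by
  refine ((continuousAt_pt hu).tendsto.comp h).congr' ?_
  filter_upwards [ha] with i hi
  exact pt_smul hi (hf i)

lemma mulVec_ne_zero (A : GLn n) {v : Vec n} (hv : v ≠ 0) : (A : Mat n) *ᵥ v ≠ 0 := by
  intro h
  exact hv (glInj A (by simpa using h))

lemma actGL_pt (A : GLn n) {v : Vec n} (hv : v ≠ 0) : actGL A (pt v) = pt ((A : Mat n) *ᵥ v) := by
  rw [pt_of_ne hv, pt_of_ne (mulVec_ne_zero A hv)]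
  exact Projectivization.map_mk _ _ _ _

lemma mk_eq_mk_iff_smul {A B : GLn n} (h : (QuotientGroup.mk A : PGLn n) = QuotientGroup.mk B) :
    ∃ c : ℂ, (B : Mat n) = c • (A : Mat n) := by
  rw [QuotientGroup.eq, Matrix.GeneralLinearGroup.mem_center_iff_val_mem_range_scalar] at h
  obtain ⟨c, hc⟩ := h
  refine ⟨c, ?_⟩
  have : (B : Mat n) = (A : Mat n) * ((A⁻¹ * B : GLn n) : Mat n) := by
    rw [← Units.val_mul]; simp
  rw [this, ← hc]
  simp [Matrix.scalar_apply, Matrix.mul_diagonal, ← Matrix.ext_iff, mul_comm]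

lemma act_mk_pt (A : GLn n) {v : Vec n} (hv : v ≠ 0) :
    act (QuotientGroup.mk A : PGLn n) (pt v) = pt ((A : Mat n) *ᵥ v) := by
  obtain ⟨c, hc⟩ := mk_eq_mk_iff_smul (A := A)
    (B := Quotient.out (QuotientGroup.mk A : PGLn n)) (QuotientGroup.out_eq' _).symm
  have hne := mulVec_ne_zero (Quotient.out (QuotientGroup.mk A : PGLn n)) hv
  rw [act, actGL_pt _ hv]
  rw [hc, Matrix.smul_mulVec] at hne ⊢
  exact pt_smul (fun h => hne (by simp [h])) (mulVec_ne_zero A hv)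

lemma act_mul (g h : PGLn n) (p : Pn n) : act (g * h) p = act g (act h p) := by
  obtain ⟨A, rfl⟩ := QuotientGroup.mk_surjective g
  obtain ⟨B, rfl⟩ := QuotientGroup.mk_surjective h
  rw [← pt_rep p, act_mk_pt B p.rep_nonzero, act_mk_pt A (mulVec_ne_zero B p.rep_nonzero),
    ← QuotientGroup.mk_mul, act_mk_pt _ p.rep_nonzero, Units.val_mul, Matrix.mulVec_mulVec]

lemma act_one (p : Pn n) : act (1 : PGLn n) p = p := by
  rw [← pt_rep p, ← QuotientGroup.mk_one, act_mk_pt _ p.rep_nonzero]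
  simp

lemma act_injective (g : PGLn n) : Function.Injective (act g : Pn n → Pn n) := by
  intro p q h
  rw [← act_one p, ← act_one q, ← inv_mul_cancel g, act_mul, act_mul, h]

lemma continuousAt_act (g : PGLn n) {v : Vec n} (hv : v 0 = 1) :
    ContinuousAt (act g : Pn n → Pn n) (pt v) := by
  obtain ⟨A, rfl⟩ := QuotientGroup.mk_surjective g
  have hv0 := ne_zero_of_apply_zero_eq_one hv
  have h1 : Tendsto (chart : Pn n → Vec n) (𝓝 (pt v)) (𝓝 v) := by
    rw [nhds_pt hv]; exact tendsto_comap
  have h2 : ContinuousAt (fun w : Vec n => pt ((A : Mat n) *ᵥ w)) v :=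
    ContinuousAt.comp (g := pt) (continuousAt_pt (mulVec_ne_zero A hv0))
      (Continuous.matrix_mulVec continuous_const continuous_id).continuousAt
  rw [ContinuousAt, act_mk_pt A hv0]
  refine (h2.tendsto.comp h1).congr' ?_
  have h3 : ∀ᶠ p in 𝓝 (pt v), chart p 0 ≠ 0 :=
    h1 ((isOpen_ne_fun (continuous_apply 0) continuous_const).mem_nhds (by simp [hv]))
  filter_upwards [h3] with p hp
  rw [Function.comp_apply, ← act_mk_pt A (ne_zero_of_apply_zero hp), pt_chart hp]

end ProjectivePoints

section HermitianForm

variable {n : ℕ}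

lemma herm_add_left (u v w : Vec n) : herm n (u + v) w = herm n u w + herm n v w := by
  simp only [herm, Pi.add_apply, add_mul, Finset.sum_add_distrib]; ring

lemma herm_smul_left (a : ℂ) (u w : Vec n) : herm n (a • u) w = a * herm n u w := by
  simp only [herm, Pi.smul_apply, smul_eq_mul, mul_add, Finset.mul_sum, mul_neg, mul_assoc]

lemma herm_conj_symm (u v : Vec n) : (starRingEnd ℂ) (herm n u v) = herm n v u := by
  simp [herm, mul_comm]

lemma herm_smul_right (a : ℂ) (u w : Vec n) :
    herm n u (a • w) = (starRingEnd ℂ) a * herm n u w := by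
  rw [← herm_conj_symm, herm_smul_left, map_mul, herm_conj_symm]

lemma herm_add_right (u v w : Vec n) : herm n u (v + w) = herm n u v + herm n u w := by
  rw [← herm_conj_symm, herm_add_left, map_add, herm_conj_symm, herm_conj_symm]

lemma herm_eq_zero_comm {u v : Vec n} : herm n u v = 0 ↔ herm n v u = 0 := by
  rw [← herm_conj_symm u v, map_eq_zero]

lemma herm_single_left (v : Vec n) : herm n (Pi.single 0 1) v = -(starRingEnd ℂ) (v 0) := by
  simp [herm]

lemma continuous_herm_left (v : Vec n) : Continuous fun u => herm n u v := by
  unfold herm; fun_prop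

lemma eq_zero_of_herm_self_re_nonpos {v : Vec n} (h0 : v 0 = 0) (h : (herm n v v).re ≤ 0) :
    v = 0 := by
  have h1 : herm n v v = ((∑ j : Fin n, ‖v j.succ‖ ^ 2 : ℝ) : ℂ) := by
    simp [herm, h0, Complex.mul_conj']
  rw [h1, Complex.ofReal_re] at h
  have h2 := (Finset.sum_eq_zero_iff_of_nonneg (fun _ _ => by positivity)).1
    (le_antisymm h (Finset.sum_nonneg fun _ _ => by positivity))
  ext i
  refine Fin.cases h0 (fun j => ?_) i
  simpa using h2 j (Finset.mem_univ j)

lemma eq_zero_of_herm_self {v : Vec n} (h0 : v 0 = 0) (h : herm n v v = 0) : v = 0 :=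
  eq_zero_of_herm_self_re_nonpos h0 (by simp [h])

variable (n) in
/-- The null vectors with first coordinate `1`: the standard lifts of the points of `∂𝐇ⁿ_ℂ`. -/
def nullLifts : Set (Vec n) := {v | v 0 = 1 ∧ herm n v v = 0}

lemma ne_zero_of_mem_nullLifts {v : Vec n} (hv : v ∈ nullLifts n) : v ≠ 0 :=
  ne_zero_of_apply_zero_eq_one hv.1

lemma eq_of_herm_eq_zero {u v : Vec n} (hu : u ∈ nullLifts n) (hv : v ∈ nullLifts n)
    (h : herm n u v = 0) : u = v := by
  have h1 : u + (-1 : ℂ) • v = 0 := by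
    apply eq_zero_of_herm_self
    · simp [hu.1, hv.1]
    · simp only [herm_add_left, herm_add_right, herm_smul_left, herm_smul_right, hu.2, hv.2, h,
        herm_eq_zero_comm.1 h]
      ring
  simpa [← sub_eq_add_neg, sub_eq_zero] using h1

lemma exists_smul_mem_nullLifts {v : Vec n} (hv : v ≠ 0) (h : herm n v v = 0) :
    ∃ a : ℂ, a ≠ 0 ∧ a • v ∈ nullLifts n := by
  have h0 : v 0 ≠ 0 := fun h0 => hv (eq_zero_of_herm_self h0 h)
  exact ⟨(v 0)⁻¹, inv_ne_zero h0, by simp [h0], by simp [herm_smul_left, herm_smul_right, h]⟩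

variable (n) in
/-- The diagonal matrix `diag(-1, 1, …, 1)` of the Hermitian form. -/
def formMat : Mat n := Matrix.diagonal (Fin.cons (-1) fun _ => 1)

lemma formMat_mul_self : formMat n * formMat n = 1 := by
  rw [formMat, Matrix.diagonal_mul_diagonal, ← Matrix.diagonal_one]
  congr 1
  ext i
  refine Fin.cases ?_ (fun j => ?_) i <;> simp

lemma formMat_conjTranspose : (formMat n)ᴴ = formMat n := by
  rw [formMat, Matrix.diagonal_conjTranspose]
  congr 1
  ext i
  refine Fin.cases ?_ (fun j => ?_) i <;> simp

lemma herm_eq_dotProduct (u v : Vec n) : herm n u v = star v ⬝ᵥ (formMat n *ᵥ u) := by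
  simp [herm, formMat, Matrix.mulVec_diagonal, dotProduct, Fin.sum_univ_succ, mul_comm]

lemma herm_mulVec (A : Mat n) (u v : Vec n) :
    herm n (A *ᵥ u) (A *ᵥ v) = star v ⬝ᵥ ((Aᴴ * formMat n * A) *ᵥ u) := by
  rw [herm_eq_dotProduct, Matrix.star_mulVec, ← Matrix.dotProduct_mulVec, Matrix.mulVec_mulVec,
    Matrix.mulVec_mulVec, Matrix.mul_assoc]

lemma conjTranspose_mul_of_unitary {A : GLn n} (hA : A ∈ unitaryGL n) :
    (A : Mat n)ᴴ * formMat n * (A : Mat n) = formMat n := by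
  ext i j
  have := hA (Pi.single j 1) (Pi.single i 1)
  rw [herm_mulVec, herm_eq_dotProduct] at this
  simpa [← Pi.single_star] using this

lemma inv_eq_of_unitary {A : GLn n} (hA : A ∈ unitaryGL n) :
    ((A⁻¹ : GLn n) : Mat n) = formMat n * (A : Mat n)ᴴ * formMat n := by
  refine Units.inv_eq_of_mul_eq_one_left ?_
  rw [Matrix.mul_assoc, Matrix.mul_assoc, ← Matrix.mul_assoc (A : Mat n)ᴴ,
    conjTranspose_mul_of_unitary hA, formMat_mul_self]

lemma mul_conjTranspose_of_unitary {A : GLn n} (hA : A ∈ unitaryGL n) :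
    (A : Mat n) * formMat n * (A : Mat n)ᴴ = formMat n := by
  have h : (A : Mat n) * ((A⁻¹ : GLn n) : Mat n) = 1 := by simp
  rw [inv_eq_of_unitary hA] at h
  calc (A : Mat n) * formMat n * (A : Mat n)ᴴ
      = ((A : Mat n) * (formMat n * (A : Mat n)ᴴ * formMat n)) * formMat n := by
        simp only [Matrix.mul_assoc, formMat_mul_self, Matrix.mul_one]
    _ = formMat n := by rw [h, Matrix.one_mul]

variable (n) in
/-- The unitary group `U(1,n)`, as a subgroup of `GL(n+1,ℂ)`. -/
def pseudoUnitary : Subgroup (GLn n) where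
  carrier := unitaryGL n
  mul_mem' {A B} hA hB u v := by
    rw [Units.val_mul, ← Matrix.mulVec_mulVec, ← Matrix.mulVec_mulVec, hA, hB]
  one_mem' u v := by simp
  inv_mem' {A} hA u v := by
    rw [← hA (((A⁻¹ : GLn n) : Mat n) *ᵥ u)]
    simp [Matrix.mulVec_mulVec]

/-- An entry of a matrix in `U(1,n)` is bounded by its upper left entry. -/
lemma norm_entry_le {A : GLn n} (hA : A ∈ unitaryGL n) (i j : Fin (n + 1)) :
    ‖(A : Mat n) i j‖ ≤ ‖(A : Mat n) 0 0‖ := by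
  have key : ∀ M : Mat n, M * formMat n * Mᴴ = formMat n → ∀ i,
      -‖M i 0‖ ^ 2 + ∑ k : Fin n, ‖M i k.succ‖ ^ 2 = (if i = 0 then -1 else 1 : ℝ) := by
    intro M hM i
    have h := congrFun (congrFun hM i) i
    rw [Matrix.mul_apply, Fin.sum_univ_succ] at h
    simp only [formMat, Matrix.mul_diagonal, Matrix.conjTranspose_apply, Fin.cons_zero,
      Fin.cons_succ, mul_one, RCLike.star_def, mul_neg, neg_mul, Complex.mul_conj',
      Matrix.diagonal_apply_eq] at h
    have h' : ((-‖M i 0‖ ^ 2 + ∑ k : Fin n, ‖M i k.succ‖ ^ 2 : ℝ) : ℂ)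
        = ((if i = 0 then -1 else 1 : ℝ) : ℂ) := by
      push_cast
      rw [h]
      refine Fin.cases ?_ (fun k => ?_) i <;> simp
    exact_mod_cast h'
  have hr := key A (mul_conjTranspose_of_unitary hA)
  have hc := key (A : Mat n)ᴴ (by
    rw [Matrix.conjTranspose_conjTranspose, conjTranspose_mul_of_unitary hA])
  simp only [Matrix.conjTranspose_apply, norm_star] at hc
  have hcol : ∀ i, ‖(A : Mat n) i 0‖ ^ 2 ≤ ‖(A : Mat n) 0 0‖ ^ 2 := by
    intro i
    refine Fin.cases le_rfl (fun k => ?_) i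
    have := Finset.single_le_sum (f := fun k : Fin n => ‖(A : Mat n) k.succ 0‖ ^ 2)
      (fun _ _ => by positivity) (Finset.mem_univ k)
    have := hc 0
    simp only [if_true] at this
    linarith
  have hrow : ∀ k : Fin n, ‖(A : Mat n) i k.succ‖ ^ 2 ≤ ‖(A : Mat n) 0 0‖ ^ 2 := by
    intro k
    have h1 := Finset.single_le_sum (f := fun k : Fin n => ‖(A : Mat n) i k.succ‖ ^ 2)
      (fun _ _ => by positivity) (Finset.mem_univ k)
    have h2 := hr i
    by_cases hi : i = 0
    · subst hi
      simp only [if_true] at h2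
      linarith
    · obtain ⟨l, rfl⟩ := Fin.exists_succ_eq.2 hi
      have h3 := Finset.single_le_sum (f := fun k : Fin n => ‖(A : Mat n) k.succ 0‖ ^ 2)
        (fun _ _ => by positivity) (Finset.mem_univ l)
      have h4 := hc 0
      simp only [if_true, if_neg hi] at h2 h4
      linarith
  refine le_of_sq_le_sq ?_ (norm_nonneg _)
  exact Fin.cases (hcol i) hrow j

end HermitianForm

section Attraction

variable {n : ℕ}

/-- The sequence `A` in `U(1,n)` tends to infinity and, rescaled by its upper left entries,
converges to the rank one map `u ↦ -⟨u, y⟩ x` with `x` and `y` null.  Then `x` spans the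
attracting point of the sequence and `y` its repelling point. -/
structure Attracts (A : ℕ → GLn n) (x y : Vec n) : Prop where
  unitary : ∀ m, A m ∈ unitaryGL n
  attr_mem : x ∈ nullLifts n
  rep_mem : y ∈ nullLifts n
  norm_tendsto : Tendsto (fun m => ‖(A m : Mat n) 0 0‖) atTop atTop
  tendsto : ∀ u, Tendsto (fun m => ((A m : Mat n) 0 0)⁻¹ • ((A m : Mat n) *ᵥ u)) atTop
    (𝓝 (-(herm n u y) • x))

lemma exists_tendsto_of_entries_bounded {ι κ : Type*} [Finite ι] [Finite κ] (M : ℕ → ι → κ → ℂ)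
    (R : ℝ) (h : ∀ m i j, ‖M m i j‖ ≤ R) :
    ∃ B : ι → κ → ℂ, ∃ φ : ℕ → ℕ, StrictMono φ ∧ Tendsto (fun m => M (φ m)) atTop (𝓝 B) := by
  have hK : IsCompact (Set.univ.pi fun _ => Set.univ.pi fun _ => Metric.closedBall 0 R :
      Set (ι → κ → ℂ)) :=
    isCompact_univ_pi fun _ => isCompact_univ_pi fun _ => isCompact_closedBall _ _
  obtain ⟨B, -, φ, hφ, hB⟩ := hK.tendsto_subseq (x := M) fun m => by simpa [Set.mem_pi] using h m
  exact ⟨B, φ, hφ, hB⟩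

lemma exists_tendsto_of_bounded (M : ℕ → Mat n) (R : ℝ) (h : ∀ m i j, ‖M m i j‖ ≤ R) :
    ∃ B : Mat n, ∃ φ : ℕ → ℕ, StrictMono φ ∧ Tendsto (fun m => M (φ m)) atTop (𝓝 B) :=
  exists_tendsto_of_entries_bounded M R h

lemma tendsto_inv_of_unitary {A : ℕ → GLn n} (hA : ∀ m, A m ∈ unitaryGL n) {B : Mat n}
    (h : Tendsto (fun m => (A m : Mat n)) atTop (𝓝 B)) :
    Tendsto (fun m => ((A m)⁻¹ : GLn n).val) atTop (𝓝 (formMat n * Bᴴ * formMat n)) := by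
  have hc : Continuous fun M : Mat n => formMat n * Mᴴ * formMat n :=
    (continuous_const.matrix_mul continuous_id.matrix_conjTranspose).matrix_mul continuous_const
  have h1 := (hc.tendsto B).comp h
  refine Tendsto.congr (fun m => ?_) h1
  rw [inv_eq_of_unitary (hA m), Function.comp_apply]

lemma tendsto_GL_one {A : ℕ → GLn n}
    (h1 : Tendsto (fun m => (A m : Mat n)) atTop (𝓝 1))
    (h2 : Tendsto (fun m => ((A m)⁻¹ : GLn n).val) atTop (𝓝 1)) :
    Tendsto A atTop (𝓝 1) := by
  rw [Units.isEmbedding_embedProduct.isInducing.tendsto_nhds_iff]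
  exact h1.prodMk_nhds ((MulOpposite.continuous_op.tendsto _).comp h2)

lemma tendsto_norm_atTop {G : Subgroup (PGLn n)} (hdisc : DiscreteTopology ↥G)
    {A : ℕ → GLn n} (hA : ∀ m, A m ∈ unitaryGL n) (hG : ∀ m, (QuotientGroup.mk (A m) : PGLn n) ∈ G)
    (hcof : Tendsto (fun m => (QuotientGroup.mk (A m) : PGLn n)) atTop cofinite) :
    Tendsto (fun m => ‖(A m : Mat n) 0 0‖) atTop atTop := by
  by_contra hnot
  rw [tendsto_atTop] at hnot
  push Not at hnot
  obtain ⟨R, hR⟩ := hnot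
  obtain ⟨φ, hφ, hφR⟩ := extraction_of_frequently_atTop hR
  obtain ⟨B, ψ, hψ, hB⟩ := exists_tendsto_of_bounded (fun m => (A (φ m) : Mat n)) R
    fun m i j => (norm_entry_le (hA _) i j).trans (hφR m).le
  set D : ℕ → GLn n := fun m => A (φ (ψ m)) with hD
  have hDu : ∀ m, D m ∈ unitaryGL n := fun m => hA _
  replace hB : Tendsto (fun m => (D m : Mat n)) atTop (𝓝 B) := hB
  have hB1 : Tendsto (fun m => (D (m + 1) : Mat n)) atTop (𝓝 B) :=
    hB.comp (tendsto_add_atTop_nat 1)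
  have hone : formMat n * Bᴴ * formMat n * B = 1 := by
    refine tendsto_nhds_unique ((tendsto_inv_of_unitary hDu hB).mul hB) ?_
    simp
  have hlim : Tendsto (fun m => (D m)⁻¹ * D (m + 1)) atTop (𝓝 1) := by
    apply tendsto_GL_one
    · have := (tendsto_inv_of_unitary hDu hB).mul hB1
      rw [hone] at this
      exact this
    · have := (tendsto_inv_of_unitary (fun m => hDu (m + 1)) hB1).mul hB
      rw [hone] at this
      refine this.congr fun m => ?_
      rw [_root_.mul_inv_rev, inv_inv, Units.val_mul]
  set g : ℕ → G := fun m => ⟨QuotientGroup.mk (D m), hG _⟩ with hg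
  have hglim : Tendsto (fun m => (g m)⁻¹ * g (m + 1)) atTop (𝓝 1) := by
    rw [tendsto_subtype_rng]
    exact (QuotientGroup.continuous_mk.tendsto (1 : GLn n)).comp hlim
  rw [nhds_discrete, tendsto_pure, eventually_atTop] at hglim
  obtain ⟨N, hN⟩ := hglim
  have hconst : ∀ m ≥ N, g m = g N := by
    intro m hm
    induction m, hm using Nat.le_induction with
    | base => rfl
    | succ m hm ih => rw [← ih]; exact (inv_mul_eq_one.1 (hN m hm)).symm
  have hev : ∀ᶠ m in atTop, (g m : PGLn n) ≠ g N :=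
    (hcof.comp ((hφ.comp hψ).tendsto_atTop)).eventually
      (Set.finite_singleton (g N : PGLn n)).eventually_cofinite_notMem
  obtain ⟨m, hm1, hm2⟩ := (hev.and (eventually_ge_atTop N)).exists
  exact hm1 (by rw [hconst m hm2])

lemma exists_attracts {G : Subgroup (PGLn n)} (hdisc : DiscreteTopology ↥G)
    {A : ℕ → GLn n} (hA : ∀ m, A m ∈ unitaryGL n) (hG : ∀ m, (QuotientGroup.mk (A m) : PGLn n) ∈ G)
    (hcof : Tendsto (fun m => (QuotientGroup.mk (A m) : PGLn n)) atTop cofinite) :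
    ∃ φ : ℕ → ℕ, StrictMono φ ∧ ∃ x y, Attracts (fun m => A (φ m)) x y := by
  have hinf := tendsto_norm_atTop hdisc hA hG hcof
  obtain ⟨B, φ, hφ, hB⟩ := exists_tendsto_of_bounded
    (fun m => ((A m : Mat n) 0 0)⁻¹ • (A m : Mat n)) 1 fun m i j => by
      rw [Matrix.smul_apply, smul_eq_mul, norm_mul, norm_inv]
      exact inv_mul_le_one_of_le₀ (norm_entry_le (hA m) i j) (norm_nonneg _)
  have hnorm := hinf.comp hφ.tendsto_atTop
  have hne : ∀ᶠ m in atTop, (A (φ m) : Mat n) 0 0 ≠ 0 := by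
    filter_upwards [hnorm.eventually_gt_atTop 0] with m hm
    exact norm_pos_iff.1 hm
  have hzero : Tendsto (fun m => ((A (φ m) : Mat n) 0 0)⁻¹) atTop (𝓝 0) :=
    (tendsto_inv₀_cobounded).comp (tendsto_norm_atTop_iff_cobounded.1 hnorm)
  have hsq : Tendsto (fun m => (star ((A (φ m) : Mat n) 0 0)⁻¹ * ((A (φ m) : Mat n) 0 0)⁻¹) •
      formMat n) atTop (𝓝 0) := by
    have := ((hzero.star.mul hzero).smul_const (formMat n))
    simpa using this
  have hB00 : B 0 0 = 1 := by
    refine tendsto_nhds_unique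
      (((continuous_id.matrix_elem 0 0 : Continuous fun M : Mat n => M 0 0).tendsto B).comp hB) ?_
    refine tendsto_const_nhds.congr' ?_
    filter_upwards [hne] with m hm
    simp [hm]
  have hB1 : Bᴴ * formMat n * B = 0 := by
    refine tendsto_nhds_unique
      (((show Continuous fun M : Mat n => Mᴴ * formMat n * M by fun_prop).tendsto B).comp hB) ?_
    refine hsq.congr fun m => ?_
    simp only [Function.comp_apply, Matrix.conjTranspose_smul, Matrix.smul_mul, Matrix.mul_smul,
      smul_smul, conjTranspose_mul_of_unitary (hA _)]
    rw [mul_comm]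
  have hB2 : B * formMat n * Bᴴ = 0 := by
    refine tendsto_nhds_unique
      (((show Continuous fun M : Mat n => M * formMat n * Mᴴ by fun_prop).tendsto B).comp hB) ?_
    refine hsq.congr fun m => ?_
    simp only [Function.comp_apply, Matrix.conjTranspose_smul, Matrix.smul_mul, Matrix.mul_smul,
      smul_smul, mul_conjTranspose_of_unitary (hA _)]
  have hiso : ∀ u v, herm n (B *ᵥ u) (B *ᵥ v) = 0 := by
    intro u v
    rw [herm_mulVec, hB1]
    simp
  set e : Vec n := Pi.single 0 1 with he
  have hBe : (B *ᵥ e) 0 = 1 := by simp [he, hB00]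
  set y : Vec n := -(formMat n *ᵥ (Bᴴ *ᵥ e)) with hy
  have hyform : ∀ u, -herm n u y = (B *ᵥ u) 0 := by
    intro u
    rw [herm_eq_dotProduct, hy, star_neg, neg_dotProduct, neg_neg, Matrix.star_mulVec,
      Matrix.star_mulVec, Matrix.conjTranspose_conjTranspose, formMat_conjTranspose,
      ← Matrix.dotProduct_mulVec, Matrix.mulVec_mulVec, formMat_mul_self, Matrix.one_mulVec,
      ← Matrix.dotProduct_mulVec]
    simp [he]
  have hrank : ∀ u, B *ᵥ u = -(herm n u y) • (B *ᵥ e) := by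
    intro u
    have h0 : B *ᵥ (u - (B *ᵥ u) 0 • e) = 0 := by
      refine eq_zero_of_herm_self ?_ (hiso _ _)
      rw [Matrix.mulVec_sub, Matrix.mulVec_smul, Pi.sub_apply, Pi.smul_apply, hBe]
      simp
    rw [hyform]
    rwa [Matrix.mulVec_sub, Matrix.mulVec_smul, sub_eq_zero] at h0
  refine ⟨φ, hφ, B *ᵥ e, y, fun m => hA _, ⟨hBe, hiso _ _⟩, ⟨?_, ?_⟩, hnorm, fun u => ?_⟩
  · simp [hy, he, formMat, Matrix.mulVec_diagonal, hB00]
  · rw [← neg_eq_zero, hyform, hy, Matrix.mulVec_neg, Matrix.mulVec_mulVec, Matrix.mulVec_mulVec,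
      hB2]
    simp
  · rw [← hrank]
    refine (((show Continuous fun M : Mat n => M *ᵥ u by fun_prop).tendsto B).comp hB).congr
      fun m => ?_
    simp [Matrix.smul_mulVec]

namespace Attracts

variable {A : ℕ → GLn n} {x y : Vec n}

lemma tendsto_inv (h : Attracts A x y) : Tendsto (fun m => ((A m : Mat n) 0 0)⁻¹) atTop (𝓝 0) :=
  tendsto_inv₀_cobounded.comp (tendsto_norm_atTop_iff_cobounded.1 h.norm_tendsto)

/-- Away from the hyperplane tangent at the repelling point, orbits tend to the attracting
point. -/
lemma tendsto_act (h : Attracts A x y) {u : Vec n} (hu : u ≠ 0) (huy : herm n u y ≠ 0) :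
    Tendsto (fun m => act (QuotientGroup.mk (A m) : PGLn n) (pt u)) atTop (𝓝 (pt x)) := by
  simp_rw [act_mk_pt _ hu]
  rw [← pt_smul (neg_ne_zero.2 huy) (ne_zero_of_mem_nullLifts h.attr_mem)]
  refine tendsto_pt_smul (smul_ne_zero (neg_ne_zero.2 huy) (ne_zero_of_mem_nullLifts h.attr_mem))
    (fun m => mulVec_ne_zero _ hu) ?_ (h.tendsto u)
  filter_upwards [h.norm_tendsto.eventually_gt_atTop 0] with m hm
  exact inv_ne_zero (norm_pos_iff.1 hm)

lemma tendsto_act_null (h : Attracts A x y) {u : Vec n} (hu : u ∈ nullLifts n) (huy : u ≠ y) :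
    Tendsto (fun m => act (QuotientGroup.mk (A m) : PGLn n) (pt u)) atTop (𝓝 (pt x)) :=
  h.tendsto_act (ne_zero_of_mem_nullLifts hu) fun h0 => huy (eq_of_herm_eq_zero hu h.rep_mem h0)

lemma tendsto_act_basePt (h : Attracts A x y) :
    Tendsto (fun m => act (QuotientGroup.mk (A m) : PGLn n) (basePt n)) atTop (𝓝 (pt x)) := by
  rw [basePt_eq_pt]
  refine h.tendsto_act (ne_zero_of_apply_zero_eq_one (by simp)) ?_
  simp [herm_single_left, h.rep_mem.1]

/-- If the eigenvalues at a null vector stay bounded, it spans the repelling point. -/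
lemma rep_eq (h : Attracts A x y) {z : Vec n} (hz : z ∈ nullLifts n) {μ : ℕ → ℂ} {R : ℝ}
    (hμ : ∀ m, (A m : Mat n) *ᵥ z = μ m • z) (hR : ∀ m, ‖μ m‖ ≤ R) : y = z := by
  have h1 : Tendsto (fun m => ((A m : Mat n) 0 0)⁻¹ * μ m) atTop (𝓝 0) :=
    h.tendsto_inv.zero_mul_isBoundedUnder_le
      (isBoundedUnder_of ⟨R, fun m => hR m⟩)
  have h2 := h1.smul_const z
  have h3 := h.tendsto z
  simp_rw [hμ, smul_smul] at h3
  have h4 := tendsto_nhds_unique h2 h3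
  rw [zero_smul, eq_comm, smul_eq_zero, neg_eq_zero] at h4
  have h5 := h4.resolve_right (ne_zero_of_mem_nullLifts h.attr_mem)
  exact (eq_of_herm_eq_zero hz h.rep_mem h5).symm

/-- If the eigenvalues at a null vector stay away from `0`, it spans the attracting point. -/
lemma attr_eq (h : Attracts A x y) {z : Vec n} (hz : z ∈ nullLifts n) {μ : ℕ → ℂ} {R : ℝ}
    (hμ : ∀ m, (A m : Mat n) *ᵥ z = μ m • z) (hμ0 : ∀ m, μ m ≠ 0) (hR : ∀ m, ‖μ m‖⁻¹ ≤ R) :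
    x = z := by
  have hx0 := h.attr_mem.1
  set e : Vec n := Pi.single 0 1 with he
  have h1 : ∀ m, herm n ((A m : Mat n) *ᵥ e) z = -((starRingEnd ℂ) (μ m))⁻¹ := by
    intro m
    have := h.unitary m e z
    rw [hμ, herm_smul_right, he, herm_single_left, hz.1, map_one] at this
    have h0 : (starRingEnd ℂ) (μ m) ≠ 0 := by simpa using hμ0 m
    field_simp
    linear_combination this
  have h2 : Tendsto (fun m => ((A m : Mat n) 0 0)⁻¹ * -((starRingEnd ℂ) (μ m))⁻¹) atTop (𝓝 0) :=
    h.tendsto_inv.zero_mul_isBoundedUnder_le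
      (isBoundedUnder_of ⟨R, fun m => by simpa using hR m⟩)
  have h3 := ((continuous_herm_left z).tendsto _).comp (h.tendsto e)
  have h4 := tendsto_nhds_unique h2 (h3.congr fun m => by
    rw [Function.comp_apply, herm_smul_left, h1])
  refine eq_of_herm_eq_zero h.attr_mem hz ?_
  rw [herm_smul_left, he, herm_single_left, h.rep_mem.1] at h4
  simpa using h4.symm

end Attracts

end Attraction

section LimitSet

variable {n : ℕ}

lemma isClosed_herm_rep_re_nonpos : IsClosed {p : Pn n | (herm n p.rep p.rep).re ≤ 0} := by
  rw [← isQuotientMap_mk'.isClosed_preimage]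
  have hc : Continuous fun w : {v : Vec n // v ≠ 0} => (herm n w.1 w.1).re := by
    have h1 : Continuous fun v : Vec n => herm n v v := by unfold herm; fun_prop
    exact Complex.continuous_re.comp (h1.comp continuous_subtype_val)
  convert isClosed_le hc (continuous_const (y := (0 : ℝ))) using 1
  ext ⟨w, hw⟩
  obtain ⟨a, ha⟩ := Projectivization.exists_smul_eq_mk_rep ℂ w hw
  change (herm n (Projectivization.mk ℂ w hw).rep (Projectivization.mk ℂ w hw).rep).re ≤ 0 ↔
    (herm n w w).re ≤ 0
  have h1 : herm n ((a : ℂ) • w) ((a : ℂ) • w) = ((‖(a : ℂ)‖ ^ 2 : ℝ) : ℂ) * herm n w w := by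
    rw [herm_smul_left, herm_smul_right, ← mul_assoc, Complex.mul_conj']
    push_cast
    rfl
  rw [← ha, Units.smul_def, h1, Complex.re_ofReal_mul]
  have : 0 < ‖(a : ℂ)‖ ^ 2 := by
    have := norm_pos_iff.2 a.ne_zero
    positivity
  exact ⟨fun h => nonpos_of_mul_nonpos_right h this,
    fun h => mul_nonpos_of_nonneg_of_nonpos this.le h⟩

lemma herm_rep_pt_re_nonpos {v : Vec n} (hv : v ≠ 0) (h : (herm n v v).re ≤ 0) :
    (herm n (pt v).rep (pt v).rep).re ≤ 0 := by
  obtain ⟨a, ha⟩ := (pt_eq_iff (pt v).rep_nonzero hv).1 (pt_rep _)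
  rw [← ha, herm_smul_left, herm_smul_right, ← mul_assoc, Complex.mul_conj', ← Complex.ofReal_pow,
    Complex.re_ofReal_mul]
  exact mul_nonpos_of_nonneg_of_nonpos (by positivity) h

lemma exists_eq_pt_of_herm_rep {p : Pn n} (hp : (herm n p.rep p.rep).re ≤ 0) :
    ∃ v : Vec n, v 0 = 1 ∧ p = pt v := by
  have h0 : p.rep 0 ≠ 0 := fun h => p.rep_nonzero (eq_zero_of_herm_self_re_nonpos h hp)
  refine ⟨(p.rep 0)⁻¹ • p.rep, by simp [h0], ?_⟩
  rw [pt_smul (inv_ne_zero h0) p.rep_nonzero, pt_rep]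

lemma herm_rep_re_nonpos_of_mem {G : Subgroup (PGLn n)} (hPU : (G : Set (PGLn n)) ⊆ PUset n)
    {z : Pn n} (hz : z ∈ LambdaCG G) : (herm n z.rep z.rep).re ≤ 0 := by
  obtain ⟨g, -, hlim⟩ := hz
  refine isClosed_herm_rep_re_nonpos.mem_of_tendsto hlim (Eventually.of_forall fun m => ?_)
  obtain ⟨A, hA, hAg⟩ := hPU (g m).2
  have he : (Pi.single 0 1 : Vec n) ≠ 0 := ne_zero_of_apply_zero_eq_one (by simp)
  rw [Set.mem_ofPred_eq, ← hAg, basePt_eq_pt, act_mk_pt A he]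
  refine herm_rep_pt_re_nonpos (mulVec_ne_zero A he) ?_
  rw [hA, herm_single_left]
  simp

/-- Every limit point is the attracting point of a sequence in the group. -/
lemma exists_attracts_of_mem {G : Subgroup (PGLn n)} (hPU : (G : Set (PGLn n)) ⊆ PUset n)
    (hdisc : DiscreteTopology ↥G) {z : Pn n} (hz : z ∈ LambdaCG G) :
    ∃ A x y, Attracts A x y ∧ z = pt x ∧ ∀ m, (QuotientGroup.mk (A m) : PGLn n) ∈ G := by
  obtain ⟨v, hv, rfl⟩ := exists_eq_pt_of_herm_rep (herm_rep_re_nonpos_of_mem hPU hz)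
  obtain ⟨g, hg, hlim⟩ := hz
  choose A hA hAg using fun m => hPU (g m).2
  have hcof : Tendsto (fun m => (QuotientGroup.mk (A m) : PGLn n)) atTop cofinite := by
    simp_rw [hAg, ← Nat.cofinite_eq_atTop]
    exact (Subtype.val_injective.comp hg).tendsto_cofinite
  obtain ⟨φ, hφ, x, y, hxy⟩ := exists_attracts hdisc hA (fun m => by rw [hAg]; exact (g m).2) hcof
  refine ⟨_, x, y, hxy, ?_, fun m => by rw [hAg]; exact (g _).2⟩
  have h1 := hlim.comp hφ.tendsto_atTop
  have h2 := hxy.tendsto_act_basePt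
  simp_rw [hAg] at h2
  rw [tendsto_pt_unique hv hxy.attr_mem.1 h1 h2]

lemma exists_nullLift_of_mem {G : Subgroup (PGLn n)} (hPU : (G : Set (PGLn n)) ⊆ PUset n)
    (hdisc : DiscreteTopology ↥G) {z : Pn n} (hz : z ∈ LambdaCG G) :
    ∃ v ∈ nullLifts n, z = pt v := by
  obtain ⟨A, x, y, h, rfl, -⟩ := exists_attracts_of_mem hPU hdisc hz
  exact ⟨x, h.attr_mem, rfl⟩

lemma act_mem_LambdaCG {G : Subgroup (PGLn n)} (hPU : (G : Set (PGLn n)) ⊆ PUset n) {g : PGLn n}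
    (hg : g ∈ G) {z : Pn n} (hz : z ∈ LambdaCG G) : act g z ∈ LambdaCG G := by
  obtain ⟨v, hv, rfl⟩ := exists_eq_pt_of_herm_rep (herm_rep_re_nonpos_of_mem hPU hz)
  obtain ⟨k, hk, hlim⟩ := hz
  refine ⟨fun m => ⟨g, hg⟩ * k m, fun i j hij => hk (mul_left_cancel hij), ?_⟩
  refine ((continuousAt_act g hv).tendsto.comp hlim).congr fun m => ?_
  rw [Function.comp_apply, ← act_mul]
  rfl

lemma mem_LambdaCG_of_infinite {G : Subgroup (PGLn n)} {v : Vec n} (hv : v 0 = 1)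
    (h : ∀ W ∈ 𝓝 (pt v), {g : G | act (g : PGLn n) (basePt n) ∈ W}.Infinite) :
    pt v ∈ LambdaCG G := by
  have hcg : (𝓝 (pt v)).IsCountablyGenerated := by rw [nhds_pt hv]; infer_instance
  obtain ⟨U, hU⟩ := (𝓝 (pt v)).exists_antitone_basis
  obtain ⟨f, hf1, hf2⟩ := exists_seq_of_forall_finset_exists
    (fun p : G × ℕ => act (p.1 : PGLn n) (basePt n) ∈ U p.2)
    (fun p q => p.1 ≠ q.1 ∧ p.2 < q.2) (fun s _ => by
      classical
      obtain ⟨g, hg, hgs⟩ := (h _ (hU.mem (s.sup Prod.snd + 1))).exists_notMem_finset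
        (s.image Prod.fst)
      refine ⟨(g, s.sup Prod.snd + 1), hg, fun p hp => ⟨?_, ?_⟩⟩
      · rintro rfl
        exact hgs (Finset.mem_image_of_mem _ hp)
      · exact Nat.lt_succ_of_le (Finset.le_sup (f := Prod.snd) hp))
  have hmono : StrictMono fun m => (f m).2 := fun i j hij => (hf2 i j hij).2
  refine ⟨fun m => (f m).1, fun i j hij => ?_, ?_⟩
  · rcases lt_trichotomy i j with hlt | heq | hlt
    · exact absurd hij (hf2 i j hlt).1
    · exact heq
    · exact absurd hij.symm (hf2 j i hlt).1
  · exact hU.tendsto fun m => hU.antitone (hmono.le_apply) (hf1 m)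

lemma isClosed_LambdaCG {G : Subgroup (PGLn n)} (hPU : (G : Set (PGLn n)) ⊆ PUset n) :
    IsClosed (LambdaCG G) := by
  refine isClosed_of_closure_subset fun z hz => ?_
  have hz' : (herm n z.rep z.rep).re ≤ 0 := closure_minimal
    (fun p hp => herm_rep_re_nonpos_of_mem hPU hp) isClosed_herm_rep_re_nonpos hz
  obtain ⟨v, hv, rfl⟩ := exists_eq_pt_of_herm_rep hz'
  refine mem_LambdaCG_of_infinite hv fun W hW => ?_
  obtain ⟨O, hOW, hO, hvO⟩ := mem_nhds_iff.1 hW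
  obtain ⟨w, hwO, g, hg, hlim⟩ := mem_closure_iff.1 hz O hO hvO
  obtain ⟨N, hN⟩ := eventually_atTop.1 (hlim (hO.mem_nhds hwO))
  exact Set.infinite_of_injective_forall_mem (f := fun m => g (m + N))
    (fun i j hij => Nat.add_right_cancel (hg hij)) fun m => hOW (hN _ (Nat.le_add_left _ _))

lemma interior_LambdaCG {G : Subgroup (PGLn n)} (hPU : (G : Set (PGLn n)) ⊆ PUset n)
    (hdisc : DiscreteTopology ↥G) : interior (LambdaCG G) = ∅ := by
  refine Set.eq_empty_iff_forall_notMem.2 fun z hz => ?_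
  obtain ⟨v, hv, rfl⟩ := exists_nullLift_of_mem hPU hdisc (interior_subset hz)
  have hv0 := ne_zero_of_mem_nullLifts hv
  set e : Vec n := Pi.single 0 1 with he
  have hlim : Tendsto (fun t : ℝ => pt (v + (t : ℂ) • e)) (𝓝[>] 0) (𝓝 (pt v)) := by
    have h1 : Tendsto (fun t : ℝ => v + (t : ℂ) • e) (𝓝[>] 0) (𝓝 v) := by
      have : Continuous fun t : ℝ => v + (t : ℂ) • e := by fun_prop
      simpa using this.continuousWithinAt (s := Set.Ioi 0) (x := 0) |>.tendsto
    exact (continuousAt_pt hv0).tendsto.comp h1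
  obtain ⟨t, ht, ht0⟩ :=
    ((hlim.eventually (mem_interior_iff_mem_nhds.1 hz)).and self_mem_nhdsWithin).exists
  replace ht0 : 0 < t := ht0
  replace ht : pt (v + (t : ℂ) • e) ∈ LambdaCG G := ht
  obtain ⟨u, hu, htu⟩ := exists_nullLift_of_mem hPU hdisc ht
  have hne : v + (t : ℂ) • e ≠ 0 := by
    apply ne_zero_of_apply_zero
    simp only [he, Pi.add_apply, hv.1, Pi.smul_apply, Pi.single_eq_same, smul_eq_mul, mul_one]
    exact_mod_cast (by positivity : (1 + t : ℝ) ≠ 0)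
  obtain ⟨a, ha⟩ := (pt_eq_iff hne (ne_zero_of_mem_nullLifts hu)).1 htu
  have h1 : herm n (v + (t : ℂ) • e) (v + (t : ℂ) • e) = 0 := by
    rw [← ha, herm_smul_left, herm_smul_right, hu.2]; simp
  have hev : herm n e v = -1 := by rw [he, herm_single_left, hv.1, map_one]
  have hve : herm n v e = -1 := by rw [← herm_conj_symm, hev]; simp
  have hee : herm n e e = -1 := by rw [he, herm_single_left]; simp
  simp only [herm_add_left, herm_add_right, herm_smul_left, herm_smul_right, hv.2, hev, hve, hee,
    Complex.conj_ofReal] at h1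
  have h2 : t * (2 + t) = 0 := by
    have : ((t * (2 + t) : ℝ) : ℂ) = 0 := by push_cast; linear_combination -h1
    exact_mod_cast this
  have : 0 < t * (2 + t) := by positivity
  exact this.ne' h2

end LimitSet

section CommonFixedPoint

variable {n : ℕ}

lemma exists_smul_of_act_eq {A : GLn n} {u v : Vec n} (hu : u ≠ 0) (hv : v ≠ 0)
    (h : act (QuotientGroup.mk A : PGLn n) (pt u) = pt v) : ∃ μ : ℂ, (A : Mat n) *ᵥ u = μ • v := by
  rw [act_mk_pt A hu, pt_eq_iff (mulVec_ne_zero A hu) hv] at h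
  obtain ⟨a, ha⟩ := h
  exact ⟨a, ha.symm⟩

lemma eigenvalue_ne_zero {A : GLn n} {u : Vec n} (hu : u ≠ 0) {μ : ℂ}
    (h : (A : Mat n) *ᵥ u = μ • u) : μ ≠ 0 := by
  rintro rfl
  exact mulVec_ne_zero A hu (by simpa using h)

lemma pow_mulVec_eq {A : Mat n} {u : Vec n} {μ : ℂ} (h : A *ᵥ u = μ • u) (m : ℕ) :
    (A ^ m) *ᵥ u = μ ^ m • u := by
  induction m with
  | zero => simp
  | succ m ih =>
    rw [pow_succ, ← Matrix.mulVec_mulVec, h, Matrix.mulVec_smul, ih, smul_smul, pow_succ, mul_comm]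

lemma inv_mulVec_eq {A : GLn n} {u : Vec n} {μ : ℂ} (hμ : μ ≠ 0)
    (h : (A : Mat n) *ᵥ u = μ • u) : ((A⁻¹ : GLn n) : Mat n) *ᵥ u = μ⁻¹ • u := by
  apply glInj A
  rw [Matrix.mulVecLin_apply, Matrix.mulVecLin_apply, Matrix.mulVec_smul, h, smul_smul,
    Matrix.mulVec_mulVec, Units.mul_inv, Matrix.one_mulVec, inv_mul_cancel₀ hμ, one_smul]

lemma act_eq_of_mulVec_eq {A : GLn n} {u : Vec n} (hu : u ≠ 0) {μ : ℂ}
    (h : (A : Mat n) *ᵥ u = μ • u) : act (QuotientGroup.mk A : PGLn n) (pt u) = pt u := by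
  rw [act_mk_pt A hu, h, pt_smul (eigenvalue_ne_zero hu h) hu]

lemma herm_mulVec_self {A : GLn n} (hA : A ∈ unitaryGL n) {z : Vec n} {μ : ℂ}
    (h : (A : Mat n) *ᵥ z = μ • z) (u : Vec n) :
    (starRingEnd ℂ) μ * herm n ((A : Mat n) *ᵥ u) z = herm n u z := by
  rw [← herm_smul_right, ← h, hA]

/-- A loxodromic element of `U(1,n)` has a second fixed point on `∂𝐇ⁿ_ℂ`. -/
lemma exists_second_eigenvector {A : GLn n} (hA : A ∈ unitaryGL n) {z : Vec n}
    (hz : z ∈ nullLifts n) {μ : ℂ} (hμ : ‖μ‖ < 1) (h : (A : Mat n) *ᵥ z = μ • z) :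
    ∃ b ∈ nullLifts n, (A : Mat n) *ᵥ b = ((starRingEnd ℂ) μ)⁻¹ • b := by
  have hμ0 : (starRingEnd ℂ) μ ≠ 0 := by
    simpa using eigenvalue_ne_zero (ne_zero_of_mem_nullLifts hz) h
  set ν : ℂ := ((starRingEnd ℂ) μ)⁻¹ with hν
  set T : Vec n →ₗ[ℂ] Vec n := (A : Mat n).mulVecLin - ν • LinearMap.id with hT
  have hns : ¬ Function.Surjective T := by
    intro hs
    obtain ⟨u, hu⟩ := hs (Pi.single 0 1)
    have h1 : herm n (T u) z = 0 := by
      have : T u = (A : Mat n) *ᵥ u + (-ν) • u := by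
        simp [hT, sub_eq_add_neg]
      rw [this, herm_add_left, herm_smul_left, ← herm_mulVec_self hA h u, ← mul_assoc, neg_mul,
        inv_mul_cancel₀ hμ0]
      ring
    rw [hu, herm_single_left, hz.1] at h1
    simp at h1
  rw [← LinearMap.injective_iff_surjective, injective_iff_map_eq_zero] at hns
  push Not at hns
  obtain ⟨b, hb, hb0⟩ := hns
  have hAb : (A : Mat n) *ᵥ b = ν • b := by
    rw [← sub_eq_zero]
    simpa [hT] using hb
  have hnull : herm n b b = 0 := by
    have h1 := herm_mulVec_self hA hAb b
    rw [hAb, herm_smul_left, ← mul_assoc, mul_comm ((starRingEnd ℂ) ν), Complex.mul_conj'] at h1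
    have hν1 : 1 < ‖ν‖ := by
      rw [hν, norm_inv, RCLike.norm_conj]
      exact (one_lt_inv₀ (by simpa using hμ0)).2 hμ
    have h2 : ((‖ν‖ : ℂ) ^ 2 - 1) * herm n b b = 0 := by rw [sub_mul, h1]; ring
    refine (mul_eq_zero.1 h2).resolve_left fun h3 => ?_
    have h4 : ‖ν‖ ^ 2 - 1 = 0 := by exact_mod_cast h3
    nlinarith
  obtain ⟨a, -, ha⟩ := exists_smul_mem_nullLifts hb0 hnull
  exact ⟨a • b, ha, by rw [Matrix.mulVec_smul, hAb, smul_comm]⟩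

/-- If a discrete subgroup fixing a boundary point contains a loxodromic element, then the whole
group fixes the second fixed point of that element. -/
lemma act_second_fixedPoint {G : Subgroup (PGLn n)} (hPU : (G : Set (PGLn n)) ⊆ PUset n)
    (hdisc : DiscreteTopology ↥G) {z b : Vec n} (hz : z ∈ nullLifts n) (hb : b ∈ nullLifts n)
    (hbz : b ≠ z) (hfix : ∀ g ∈ G, act g (pt z) = pt z) {A : GLn n} (hA : A ∈ unitaryGL n)
    (hAG : (QuotientGroup.mk A : PGLn n) ∈ G) {μ ν : ℂ} (hμ : ‖μ‖ < 1) (hν : 1 < ‖ν‖)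
    (hAz : (A : Mat n) *ᵥ z = μ • z) (hAb : (A : Mat n) *ᵥ b = ν • b) :
    ∀ g ∈ G, act g (pt b) = pt b := by
  have hz0 := ne_zero_of_mem_nullLifts hz
  have hb0 := ne_zero_of_mem_nullLifts hb
  have hpowU : ∀ m, A ^ m ∈ unitaryGL n := fun m => (pseudoUnitary n).pow_mem hA m
  have hpowG : ∀ m, (QuotientGroup.mk (A ^ m) : PGLn n) ∈ G := fun m => by
    rw [QuotientGroup.mk_pow]; exact G.pow_mem hAG m
  have hpowz : ∀ m, ((A ^ m : GLn n) : Mat n) *ᵥ z = μ ^ m • z := fun m => by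
    rw [Units.val_pow_eq_pow_val]; exact pow_mulVec_eq hAz m
  have hpowb : ∀ m, ((A ^ m : GLn n) : Mat n) *ᵥ b = ν ^ m • b := fun m => by
    rw [Units.val_pow_eq_pow_val]; exact pow_mulVec_eq hAb m
  have hinj : Function.Injective fun m : ℕ => (QuotientGroup.mk (A ^ m) : PGLn n) := by
    simp_rw [QuotientGroup.mk_pow]
    rw [injective_pow_iff_not_isOfFinOrder, isOfFinOrder_iff_pow_eq_one]
    rintro ⟨d, hd, h1⟩
    rw [← QuotientGroup.mk_pow, ← QuotientGroup.mk_one] at h1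
    obtain ⟨c, hc⟩ := mk_eq_mk_iff_smul h1.symm
    have h2 := hpowz d
    have h3 := hpowb d
    rw [hc, Units.val_one, Matrix.smul_mulVec, Matrix.one_mulVec] at h2 h3
    have h4 := smul_left_injective ℂ hz0 h2
    have h5 := smul_left_injective ℂ hb0 h3
    have h6 : ‖μ‖ ^ d = ‖ν‖ ^ d := by rw [← norm_pow, ← norm_pow, ← h4, ← h5]
    have := pow_lt_one₀ (norm_nonneg μ) hμ hd.ne'
    have := one_lt_pow₀ hν hd.ne'
    linarith
  obtain ⟨φ, hφ, x, y, hxy⟩ := exists_attracts hdisc hpowU hpowG (by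
    rw [← Nat.cofinite_eq_atTop]; exact hinj.tendsto_cofinite)
  have hyz : y = z := hxy.rep_eq hz (fun m => hpowz (φ m)) (R := 1) fun m => by
    rw [norm_pow]; exact pow_le_one₀ (norm_nonneg _) hμ.le
  subst hyz
  have hxb : x = b := by
    have h1 := hxy.tendsto_act_null hb hbz
    simp_rw [act_eq_of_mulVec_eq hb0 (hpowb _)] at h1
    exact tendsto_pt_unique hxy.attr_mem.1 hb.1 h1 tendsto_const_nhds
  subst hxb
  intro f hf
  by_contra hne
  obtain ⟨F, hF, rfl⟩ := hPU hf
  obtain ⟨κ, hκ⟩ := exists_smul_of_act_eq hz0 hz0 (hfix _ hf)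
  have hκ0 := eigenvalue_ne_zero hz0 hκ
  have hFb : Tendsto (fun m => act (QuotientGroup.mk (A ^ φ m) : PGLn n)
      (act (QuotientGroup.mk F : PGLn n) (pt x))) atTop (𝓝 (pt x)) := by
    rw [act_mk_pt F hb0]
    refine hxy.tendsto_act (mulVec_ne_zero F hb0) fun h0 => hbz ?_
    refine eq_of_herm_eq_zero hb hz ?_
    rw [← herm_mulVec_self hF hκ, h0, mul_zero]
  set K : ℕ → GLn n := fun m => A ^ φ m * F * (A ^ φ m)⁻¹ with hK
  have hKact : ∀ m, act (QuotientGroup.mk (K m) : PGLn n) (pt x) =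
      act (QuotientGroup.mk (A ^ φ m) : PGLn n) (act (QuotientGroup.mk F : PGLn n) (pt x)) := by
    intro m
    rw [hK, QuotientGroup.mk_mul, QuotientGroup.mk_mul, act_mul, act_mul,
      act_eq_of_mulVec_eq hb0 (inv_mulVec_eq (eigenvalue_ne_zero hb0 (hpowb _)) (hpowb _))]
  have hKU : ∀ m, K m ∈ unitaryGL n := fun m => (pseudoUnitary n).mul_mem
    ((pseudoUnitary n).mul_mem (hpowU _) hF) ((pseudoUnitary n).inv_mem (hpowU _))
  have hKG : ∀ m, (QuotientGroup.mk (K m) : PGLn n) ∈ G := fun m =>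
    G.mul_mem (G.mul_mem (hpowG _) hf) (G.inv_mem (hpowG _))
  have hKz : ∀ m, (K m : Mat n) *ᵥ y = κ • y := by
    intro m
    have hm := eigenvalue_ne_zero hz0 (hpowz (φ m))
    rw [hK, Units.val_mul, Units.val_mul, ← Matrix.mulVec_mulVec,
      inv_mulVec_eq hm (hpowz _), ← Matrix.mulVec_mulVec, Matrix.mulVec_smul, hκ,
      Matrix.mulVec_smul, Matrix.mulVec_smul, hpowz, smul_smul, smul_smul]
    congr 1
    field_simp
  have hcof : Tendsto (fun m => (QuotientGroup.mk (K m) : PGLn n)) atTop cofinite := by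
    rw [← Nat.cofinite_eq_atTop]
    refine Tendsto.cofinite_of_finite_preimage_singleton fun k => ?_
    by_contra hinf
    rw [Set.coe_eq_subtype] at hinf
    obtain ⟨ψ, hψ, hψk⟩ := extraction_of_frequently_atTop
      (Nat.frequently_atTop_iff_infinite.2 fun hfin => hinf hfin)
    have h1 := hFb.comp hψ.tendsto_atTop
    simp_rw [Function.comp_def, ← hKact] at h1
    have h2 : ∀ i, (QuotientGroup.mk (K (ψ i)) : PGLn n) = k := hψk
    simp_rw [h2] at h1
    have h3 := eq_pt_of_tendsto_const hb.1 h1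
    rw [← h2 0, hKact] at h3
    exact hne (act_injective _ (h3.trans (act_eq_of_mulVec_eq hb0 (hpowb _)).symm))
  obtain ⟨ψ, hψ, x', y', hxy'⟩ := exists_attracts hdisc hKU hKG hcof
  have hx' := hxy'.attr_eq hz (fun m => hKz (ψ m)) (fun _ => hκ0) (fun _ => le_rfl)
  have hy' := hxy'.rep_eq hz (fun m => hKz (ψ m)) (fun _ => le_rfl)
  have h1 := hxy'.tendsto_act_null hb (by rwa [hy'])
  simp_rw [hKact] at h1
  exact hbz ((tendsto_pt_unique hb.1 hxy'.attr_mem.1 (hFb.comp hψ.tendsto_atTop) h1).trans hx')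

/-- If a discrete subgroup of `PU(1,n)` fixes a boundary point, it has at most one other limit
point. -/
lemma LambdaCG_subset_pair {G : Subgroup (PGLn n)} (hPU : (G : Set (PGLn n)) ⊆ PUset n)
    (hdisc : DiscreteTopology ↥G) {z : Vec n} (hz : z ∈ nullLifts n)
    (hfix : ∀ g ∈ G, act g (pt z) = pt z) : ∃ b, LambdaCG G ⊆ {pt z, b} := by
  have hz0 := ne_zero_of_mem_nullLifts hz
  by_cases hlox : ∃ A ∈ unitaryGL n, (QuotientGroup.mk A : PGLn n) ∈ G ∧
      ∃ μ : ℂ, (A : Mat n) *ᵥ z = μ • z ∧ ‖μ‖ < 1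
  · obtain ⟨A, hA, hAG, μ, hAz, hμ⟩ := hlox
    obtain ⟨b, hb, hAb⟩ := exists_second_eigenvector hA hz hμ hAz
    have hb0 := ne_zero_of_mem_nullLifts hb
    have hν : 1 < ‖((starRingEnd ℂ) μ)⁻¹‖ := by
      rw [norm_inv, RCLike.norm_conj]
      exact (one_lt_inv₀ (norm_pos_iff.2 (eigenvalue_ne_zero hz0 hAz))).2 hμ
    have hbz : b ≠ z := by
      rintro rfl
      have := smul_left_injective ℂ hz0 (hAz.symm.trans hAb)
      rw [← this] at hν
      linarith
    have hfixb := act_second_fixedPoint hPU hdisc hz hb hbz hfix hA hAG hμ hν hAz hAb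
    refine ⟨pt b, fun w hw => ?_⟩
    obtain ⟨B, x, y, hxy, rfl, hBG⟩ := exists_attracts_of_mem hPU hdisc hw
    by_cases hzy : z = y
    · have h1 := hxy.tendsto_act_null hb (hzy ▸ hbz)
      simp_rw [hfixb _ (hBG _)] at h1
      rw [tendsto_pt_unique hxy.attr_mem.1 hb.1 h1 tendsto_const_nhds]
      simp
    · have h1 := hxy.tendsto_act_null hz hzy
      simp_rw [hfix _ (hBG _)] at h1
      rw [tendsto_pt_unique hxy.attr_mem.1 hz.1 h1 tendsto_const_nhds]
      simp
  · push Not at hlox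
    refine ⟨pt z, fun w hw => ?_⟩
    obtain ⟨B, x, y, hxy, rfl, hBG⟩ := exists_attracts_of_mem hPU hdisc hw
    choose μ hμ using fun m => exists_smul_of_act_eq hz0 hz0 (hfix _ (hBG m))
    have h0 : ∀ m, μ m ≠ 0 := fun m => eigenvalue_ne_zero hz0 (hμ m)
    rw [hxy.attr_eq hz hμ h0 (R := 1) fun m => inv_le_one_of_one_le₀
      (hlox _ (hxy.unitary m) (hBG m) _ (hμ m))]
    simp

end CommonFixedPoint

section Minimality

variable {n : ℕ} {G : Subgroup (PGLn n)}

lemma exists_act_ne_of_mem (hPU : (G : Set (PGLn n)) ⊆ PUset n) (hdisc : DiscreteTopology ↥G)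
    (h3 : ∃ a ∈ LambdaCG G, ∃ b ∈ LambdaCG G, ∃ c ∈ LambdaCG G, a ≠ b ∧ a ≠ c ∧ b ≠ c)
    {z : Vec n} (hz : z ∈ nullLifts n) : ∃ g ∈ G, act g (pt z) ≠ pt z := by
  by_contra! hfix
  obtain ⟨d, hd⟩ := LambdaCG_subset_pair hPU hdisc hz hfix
  obtain ⟨a, ha, b, hb, c, hc, hab, hac, hbc⟩ := h3
  rcases hd ha with rfl | rfl <;> rcases hd hb with rfl | rfl <;>
    rcases hd hc with rfl | rfl <;> simp_all

/-- The sequence attracting to a limit point attracts every limit point but the repelling one. -/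
lemma Attracts.tendsto_act_of_mem (hPU : (G : Set (PGLn n)) ⊆ PUset n)
    (hdisc : DiscreteTopology ↥G) {A : ℕ → GLn n} {x y : Vec n} (hA : Attracts A x y)
    {z : Pn n} (hz : z ∈ LambdaCG G) (hzy : z ≠ pt y) :
    Tendsto (fun m => act (QuotientGroup.mk (A m) : PGLn n) z) atTop (𝓝 (pt x)) := by
  obtain ⟨v, hv, rfl⟩ := exists_nullLift_of_mem hPU hdisc hz
  exact hA.tendsto_act_null hv fun h => hzy (h ▸ rfl)

lemma mem_closure_LambdaCG_diff_singleton (hPU : (G : Set (PGLn n)) ⊆ PUset n)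
    (hdisc : DiscreteTopology ↥G)
    (h3 : ∃ a ∈ LambdaCG G, ∃ b ∈ LambdaCG G, ∃ c ∈ LambdaCG G, a ≠ b ∧ a ≠ c ∧ b ≠ c)
    {z : Pn n} (hz : z ∈ LambdaCG G) : z ∈ closure (LambdaCG G \ {z}) := by
  obtain ⟨A, x, y, hA, rfl, hAG⟩ := exists_attracts_of_mem hPU hdisc hz
  obtain ⟨a, ha, a', ha', haa', hay, hay'⟩ : ∃ a ∈ LambdaCG G, ∃ a' ∈ LambdaCG G,
      a ≠ a' ∧ a ≠ pt y ∧ a' ≠ pt y := by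
    obtain ⟨a, ha, b, hb, c, hc, hab, hac, hbc⟩ := h3
    by_cases h1 : a = pt y
    · exact ⟨b, hb, c, hc, hbc, h1 ▸ hab.symm, h1 ▸ hac.symm⟩
    · by_cases h2 : b = pt y
      · exact ⟨a, ha, c, hc, hac, h1, h2 ▸ hbc.symm⟩
      · exact ⟨a, ha, b, hb, hab, h1, h2⟩
  rw [mem_closure_iff_nhds]
  intro W hW
  obtain ⟨m, hm, hm'⟩ := ((hA.tendsto_act_of_mem hPU hdisc ha hay).eventually_mem hW |>.and
    ((hA.tendsto_act_of_mem hPU hdisc ha' hay').eventually_mem hW)).exists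
  by_cases h : act (QuotientGroup.mk (A m) : PGLn n) a = pt x
  · exact ⟨_, hm', act_mem_LambdaCG hPU (hAG m) ha', fun h' =>
      haa' (act_injective _ (h.trans (Set.mem_singleton_iff.1 h').symm))⟩
  · exact ⟨_, hm, act_mem_LambdaCG hPU (hAG m) ha, h⟩

lemma LambdaCG_subset_closure_orbit (hPU : (G : Set (PGLn n)) ⊆ PUset n)
    (hdisc : DiscreteTopology ↥G)
    (h3 : ∃ a ∈ LambdaCG G, ∃ b ∈ LambdaCG G, ∃ c ∈ LambdaCG G, a ≠ b ∧ a ≠ c ∧ b ≠ c)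
    {z : Pn n} (hz : z ∈ LambdaCG G) :
    LambdaCG G ⊆ closure {w : Pn n | ∃ g : G, act (g : PGLn n) z = w} := by
  intro w hw
  obtain ⟨A, x, y, hA, rfl, hAG⟩ := exists_attracts_of_mem hPU hdisc hw
  obtain ⟨h, hhG, hhy⟩ : ∃ h ∈ G, act h z ≠ pt y := by
    by_cases hzy : z = pt y
    · subst hzy
      exact exists_act_ne_of_mem hPU hdisc h3 hA.rep_mem
    · exact ⟨1, G.one_mem, by rwa [act_one]⟩
  refine mem_closure_of_tendsto
    (hA.tendsto_act_of_mem hPU hdisc (act_mem_LambdaCG hPU hhG hz) hhy) (.of_forall fun m => ?_)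
  exact ⟨⟨_, G.mul_mem (hAG m) hhG⟩, act_mul _ _ _⟩

end Minimality

end

/-- For a non-elementary discrete subgroup `G` of `PU(1,n)`, the limit
set `Λ_CG(G)` is perfect (closed with no isolated points), has empty interior in
`ℙⁿ_ℂ`, and every `G`-orbit of a point of `Λ_CG(G)` is dense in `Λ_CG(G)`. -/
theorem limit_set_perfect_nowhere_dense_minimal
    (n : ℕ) (hn : 1 ≤ n) (G : Subgroup (PGLn n))
    (hPU : (G : Set (PGLn n)) ⊆ PUset n) (hdisc : DiscreteTopology ↥G)
    (h3 : ∃ a ∈ LambdaCG G, ∃ b ∈ LambdaCG G, ∃ c ∈ LambdaCG G,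
      a ≠ b ∧ a ≠ c ∧ b ≠ c) :
    IsClosed (LambdaCG G) ∧
    (∀ z ∈ LambdaCG G, z ∈ closure (LambdaCG G \ {z})) ∧
    interior (LambdaCG G) = ∅ ∧
    ∀ z ∈ LambdaCG G, LambdaCG G ⊆ closure {w : Pn n | ∃ g : G, act (g : PGLn n) z = w} := by
  exact ⟨isClosed_LambdaCG hPU, fun z hz => mem_closure_LambdaCG_diff_singleton hPU hdisc h3 hz,
    interior_LambdaCG hPU hdisc, fun z hz => LambdaCG_subset_closure_orbit hPU hdisc h3 hz⟩
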